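/- arXiv:2005.08297 — 2 statements merged into one kernel-verified Lean document; each statement's English description precedes it below -/
import Mathlib

section
/- Let 0 < α < 1. Then for every real z > 0 one has 0 < E_{α,1}(−z) < 1. -/
/-- The Mittag-Leffler function `E_{α,β}(z) = ∑_{m=0}^∞ z^m / Γ(α m + β)`. -/
noncomputable def mittagLeffler (α β z : ℝ) : ℝ :=
  ∑' m : ℕ, z ^ m / Real.Gamma (α * m + β)

open Real Set MeasureTheory Filter Topology

theorem ml_gamma_lower (x R : ℝ) (hx : 1 ≤ x) (hR : 0 < R) :
    R ^ (x - 1) * exp (-R) ≤ Gamma x := by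
  have hint := Real.GammaIntegral_convergent (s := x) (by linarith)
  rw [Real.Gamma_eq_integral (by linarith), ← integral_exp_neg_Ioi R, ← integral_const_mul]
  have hsub : Ioi R ⊆ Ioi (0:ℝ) := Ioi_subset_Ioi hR.le
  calc ∫ t in Ioi R, R ^ (x - 1) * exp (-t) 
      ≤ ∫ t in Ioi R, exp (-t) * t ^ (x - 1) := by
        refine setIntegral_mono_on ?_ (hint.mono_set hsub) measurableSet_Ioi ?_
        · exact (integrableOn_exp_neg_Ioi R).const_mul _
        · intro t ht
          rw [mul_comm]
          have : R < t := ht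
          gcongr
    _ ≤ _ := by
        refine setIntegral_mono_set hint ?_ hsub.eventuallyLE
        filter_upwards [ae_restrict_mem measurableSet_Ioi] with t ht
        have : 0 < t := ht
        positivity

theorem ml_summable_abs (α β z : ℝ) (hα : 0 < α) (hβ : 1 ≤ β) :
    Summable (fun m : ℕ => |z| ^ m / Gamma (α * m + β)) := by
  set R : ℝ := (2 * |z| + 1) ^ (1 / α) with hRdef
  have hz := abs_nonneg z
  have hR : 0 < R := by positivity
  have hRa : R ^ α = 2 * |z| + 1 := by
    rw [hRdef, ← Real.rpow_mul (by positivity)]; field_simp; simp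
  have hr : |z| / R ^ α < 1 := by rw [hRa, div_lt_one (by positivity)]; linarith
  refine Summable.of_nonneg_of_le (f := fun m : ℕ => (|z| / R ^ α) ^ m * (R ^ (β - 1) * exp (-R))⁻¹) ?_ ?_ ?_
  · intro m
    have : 0 < Gamma (α * m + β) := Gamma_pos_of_pos (by positivity)
    positivity
  · intro m
    have h := ml_gamma_lower (α * m + β) R (by nlinarith [show (0:ℝ) ≤ α * m by positivity]) hR
    have h2 : R ^ (α * m + β - 1) = (R ^ α) ^ m * R ^ (β - 1) := by
      rw [← Real.rpow_natCast, ← Real.rpow_mul hR.le, ← Real.rpow_add hR]; ring_nf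
    rw [h2] at h
    rw [div_pow, div_mul_eq_mul_div, div_eq_mul_inv _ (Gamma _), div_eq_mul_inv, mul_assoc, ← mul_inv]
    gcongr
    calc _ = (R ^ α) ^ m * R ^ (β - 1) * exp (-R) := by ring
      _ ≤ _ := h
  · exact (summable_geometric_of_lt_one (by positivity) hr).mul_right _

theorem ml_summable (α β z : ℝ) (hα : 0 < α) (hβ : 1 ≤ β) :
    Summable (fun m : ℕ => z ^ m / Gamma (α * m + β)) := by
  refine Summable.of_norm_bounded (ml_summable_abs α β z hα hβ) fun m => ?_
  have : 0 < Gamma (α * m + β) := Gamma_pos_of_pos (by positivity)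
  rw [norm_div, norm_pow, Real.norm_eq_abs, Real.norm_eq_abs, abs_of_pos this]

theorem ml_lip (α β R : ℝ) (hα : 0 < α) (hβ : 1 ≤ β) (hR : 0 < R) :
    ∃ K, 0 ≤ K ∧ ∀ x y, |x| ≤ R → |y| ≤ R →
      |mittagLeffler α β x - mittagLeffler α β y| ≤ K * |x - y| := by
  have hG : ∀ m : ℕ, 0 < Gamma (α * m + β) := fun m => Gamma_pos_of_pos (by positivity)
  have hs := (ml_summable_abs α β (2 * R) hα hβ).mul_left (1 / R)
  rw [abs_of_pos (by positivity)] at hs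
  refine ⟨∑' m : ℕ, 1 / R * ((2 * R) ^ m / Gamma (α * m + β)), tsum_nonneg fun m => ?_, fun x y hx hy => ?_⟩
  · have := hG m; positivity
  · rw [mittagLeffler, mittagLeffler, ← (ml_summable α β x hα hβ).tsum_sub (ml_summable α β y hα hβ), mul_comm,
      ← tsum_mul_left, ← Real.norm_eq_abs]
    refine tsum_of_norm_bounded (hs.mul_left |x - y|).hasSum fun m => ?_
    have := hG m
    rw [← sub_div, norm_div, Real.norm_eq_abs, Real.norm_eq_abs, abs_of_pos this]
    have h1 := abs_pow_sub_pow_le x y m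
    have h2 : (m:ℝ) * max |x| |y| ^ (m - 1) ≤ 1 / R * (2 * R) ^ m := by
      rcases m with _ | m
      · simp; positivity
      · have h3 : ((m + 1 : ℕ) : ℝ) ≤ 2 ^ (m + 1) := by exact_mod_cast (Nat.lt_two_pow_self).le
        have h4 : max |x| |y| ≤ R := max_le hx hy
        calc ((m + 1 : ℕ) : ℝ) * max |x| |y| ^ (m + 1 - 1) ≤ 2 ^ (m + 1) * R ^ m := by
              simp only [Nat.add_sub_cancel]; gcongr
          _ = _ := by rw [mul_pow, pow_succ R]; field_simp
    calc |x ^ m - y ^ m| / Gamma (α * m + β) ≤ (|x - y| * (1 / R * (2 * R) ^ m)) / Gamma (α * m + β) := by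
          gcongr
          rw [mul_assoc] at h1
          exact h1.trans (by gcongr)
      _ = _ := by ring

theorem ml_cont (α β : ℝ) (hα : 0 < α) (hβ : 1 ≤ β) : Continuous (mittagLeffler α β) := by
  rw [continuous_iff_continuousAt]
  intro x
  obtain ⟨K, hK, h⟩ := ml_lip α β (|x| + 1) hα hβ (by positivity)
  rw [ContinuousAt, tendsto_iff_norm_sub_tendsto_zero]
  have : Tendsto (fun y => K * |y - x|) (𝓝 x) (𝓝 0) := by
    have : Continuous (fun y => K * |y - x|) := by fun_prop
    simpa using this.tendsto x
  refine squeeze_zero' (Eventually.of_forall fun _ => norm_nonneg _) ?_ this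
  filter_upwards [Metric.ball_mem_nhds x one_pos] with y hy
  rw [Metric.mem_ball, Real.dist_eq] at hy
  refine h y x ?_ (by linarith)
  have := abs_add_le (y - x) x
  rw [sub_add_cancel] at this
  linarith

theorem ml_int (p b t : ℝ) (hb : 0 < b) (f : ℝ → ℝ) (hf : Continuous f) :
    IntervalIntegrable (fun s => (t - s) ^ (b - 1) * f s) volume p t := by
  have h1 : IntervalIntegrable (fun s : ℝ => s ^ (b - 1)) volume (t - p) (t - t) :=
    intervalIntegral.intervalIntegrable_rpow' (by linarith)
  have h2 := h1.comp_sub_left t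
  simp only [sub_sub_cancel] at h2
  exact h2.mul_continuousOn hf.continuousOn

theorem ml_beta (p b t : ℝ) (hp : 0 ≤ p) (hb : 0 < b) (ht : 0 < t) :
    ∫ s in 0..t, (t - s) ^ (b - 1) * s ^ p =
      t ^ (p + b) * (Gamma b * Gamma (p + 1) / Gamma (p + (1 + b))) := by
  have h := Complex.betaIntegral_scaled ((p + 1 : ℝ) : ℂ) (b : ℂ) ht
  have h2 := ProbabilityTheory.beta_eq_betaIntegralReal (p + 1) b (by linarith) hb
  have h3 : ∫ x in (0:ℝ)..t, (x : ℂ) ^ (((p + 1 : ℝ) : ℂ) - 1) * ((t : ℂ) - x) ^ ((b:ℂ) - 1)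
      = ((∫ s in (0:ℝ)..t, (t - s) ^ (b - 1) * s ^ p : ℝ) : ℂ) := by
    rw [← intervalIntegral.integral_ofReal]
    refine intervalIntegral.integral_congr fun x hx => ?_
    rw [uIcc_of_le ht.le] at hx
    have e1 := Complex.ofReal_cpow hx.1 p
    have e2 := Complex.ofReal_cpow (sub_nonneg.2 hx.2) (b - 1)
    push_cast at e1 e2 ⊢
    rw [e1, e2, add_sub_cancel_right, mul_comm]
  rw [h3] at h
  have h4 : (t:ℂ) ^ (((p + 1 : ℝ) : ℂ) + b - 1) = ((t ^ (p + b) : ℝ) : ℂ) := by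
    rw [Complex.ofReal_cpow ht.le]; push_cast; ring_nf
  rw [h4] at h
  have h5 := congrArg Complex.re h
  rw [Complex.ofReal_re, Complex.re_ofReal_mul, ← h2, ProbabilityTheory.beta] at h5
  rw [h5, show p + 1 + b = p + (1 + b) by ring, mul_comm (Gamma b)]

theorem ml_frac (α b l t : ℝ) (hα : 0 < α) (hb : 0 < b) (hl : 0 < l) (ht : 0 < t) :
    ∫ s in 0..t, (t - s) ^ (b - 1) * mittagLeffler α 1 (-(l * s ^ α)) =
      Gamma b * t ^ b * mittagLeffler α (1 + b) (-(l * t ^ α)) := by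
  have hG : ∀ m : ℕ, 0 < Gamma (α * m + 1) := fun m => Gamma_pos_of_pos (by positivity)
  have hG' : ∀ m : ℕ, 0 < Gamma (α * m + (1 + b)) := fun m => Gamma_pos_of_pos (by positivity)
  have hGb := Gamma_pos_of_pos hb
  have hI : ∀ m : ℕ, IntervalIntegrable (fun s : ℝ => (t - s) ^ (b - 1) * s ^ (α * m)) volume 0 t := by
    intro m
    exact ml_int 0 b t hb _ (Real.continuous_rpow_const (by positivity))
  have key := hasSum_integral_of_summable_integral_norm (μ := volume.restrict (Ioc 0 t))
    (F := fun (m : ℕ) s => ((-l) ^ m / Gamma (α * m + 1)) * ((t - s) ^ (b - 1) * s ^ (α * m))) ?_ ?_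
  · rw [intervalIntegral.integral_of_le ht.le]
    have e : ∫ s in Ioc 0 t, (t - s) ^ (b - 1) * mittagLeffler α 1 (-(l * s ^ α))
        = ∫ s in Ioc 0 t, ∑' m : ℕ, ((-l) ^ m / Gamma (α * m + 1)) * ((t - s) ^ (b - 1) * s ^ (α * m)) := by
      refine setIntegral_congr_fun measurableSet_Ioc fun s hs => ?_
      simp only [mittagLeffler]
      rw [← tsum_mul_left]
      refine tsum_congr fun m => ?_
      rw [Real.rpow_mul hs.1.le, Real.rpow_natCast, ← neg_mul, mul_pow]; ring
    rw [e, ← key.tsum_eq, mittagLeffler, ← tsum_mul_left]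
    refine tsum_congr fun m => ?_
    rw [integral_const_mul, ← intervalIntegral.integral_of_le ht.le, ml_beta _ _ _ (by positivity) hb ht,
      Real.rpow_add ht, Real.rpow_mul ht.le, Real.rpow_natCast, ← neg_mul, mul_pow]
    have := (hG m).ne'
    field_simp
  · intro m
    have := hI m
    rw [intervalIntegrable_iff_integrableOn_Ioc_of_le ht.le] at this
    exact this.const_mul _
  · have := (ml_summable_abs α (1 + b) (l * t ^ α) hα (by linarith)).mul_left (Gamma b * t ^ b)
    refine this.congr fun m => ?_
    have e : ∫ s in Ioc 0 t, ‖((-l) ^ m / Gamma (α * m + 1)) * ((t - s) ^ (b - 1) * s ^ (α * m))‖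
        = ∫ s in Ioc 0 t, (l ^ m / Gamma (α * m + 1)) * ((t - s) ^ (b - 1) * s ^ (α * m)) := by
      refine setIntegral_congr_fun measurableSet_Ioc fun s hs => ?_
      have h1 : 0 ≤ (t - s) ^ (b - 1) * s ^ (α * m) :=
        mul_nonneg (Real.rpow_nonneg (by linarith [hs.2]) _) (Real.rpow_nonneg hs.1.le _)
      simp only [norm_mul, norm_div, norm_pow, norm_neg, Real.norm_eq_abs, abs_of_pos hl, abs_of_pos (hG m)]
      rw [← abs_mul, abs_of_nonneg h1]
    rw [e, integral_const_mul, ← intervalIntegral.integral_of_le ht.le, ml_beta _ _ _ (by positivity) hb ht,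
      Real.rpow_add ht, Real.rpow_mul ht.le, Real.rpow_natCast, abs_of_pos (by positivity), mul_pow]
    have := (hG m).ne'
    field_simp

theorem ml_rec (α b z : ℝ) (hα : 0 < α) (hb : 1 ≤ b) :
    mittagLeffler α b z = 1 / Gamma b + z * mittagLeffler α (b + α) z := by
  rw [mittagLeffler, (ml_summable α b z hα hb).tsum_eq_zero_add, mittagLeffler, ← tsum_mul_left]
  congr 1
  · simp
  · refine tsum_congr fun m => ?_
    rw [pow_succ]; push_cast
    rw [show α * ((m:ℝ) + 1) + b = α * m + (b + α) by ring]; ring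

theorem ml_caputo (α l t : ℝ) (hα : 0 < α) (hα1 : α < 1) (hl : 0 < l) (ht : 0 < t) :
    ∫ s in 0..t, (t - s) ^ (1 - α - 1) * mittagLeffler α 1 (-(l * s ^ α)) =
      t ^ (1 - α) / (1 - α) -
        Gamma (1 - α) * l * ∫ s in 0..t, mittagLeffler α 1 (-(l * s ^ α)) := by
  have h1 := ml_frac α 1 l t hα one_pos hl ht
  simp only [sub_self, Real.rpow_zero, one_mul, Real.Gamma_one, Real.rpow_one] at h1
  rw [h1, ml_frac α (1 - α) l t hα (by linarith) hl ht, ml_rec α (1 + (1 - α)) _ hα (by linarith),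
    add_comm 1 (1 - α), Real.Gamma_add_one (by linarith)]
  have hG := Gamma_pos_of_pos (show 0 < 1 - α by linarith)
  have hb : 1 - α ≠ 0 := by linarith
  have ht' : t ^ (1 - α) * t ^ α = t := by rw [← Real.rpow_add ht]; simp
  rw [show 1 - α + 1 + α = 1 + 1 by ring]
  rw [mul_add, show Gamma (1 - α) * t ^ (1 - α) * (-(l * t ^ α) * mittagLeffler α (1 + 1) (-(l * t ^ α)))
    = - (Gamma (1 - α) * l * ((t ^ (1 - α) * t ^ α) * mittagLeffler α (1 + 1) (-(l * t ^ α)))) by ring, ht']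
  field_simp
  ring

theorem ml_no_zero (α l : ℝ) (hα : 0 < α) (hα1 : α < 1) (hl : 0 < l)
    (hpos : ∀ s, 0 ≤ s → s < 1 → 0 < mittagLeffler α 1 (-(l * s ^ α)))
    (hzero : mittagLeffler α 1 (-l) = 0) : False := by
  obtain ⟨K, hK, hlip⟩ := ml_lip α 1 l hα le_rfl hl
  set v : ℝ → ℝ := fun s => mittagLeffler α 1 (-(l * s ^ α)) with hv
  have hvc : Continuous v :=
    (ml_cont α 1 hα le_rfl).comp (((Real.continuous_rpow_const hα.le).const_mul l).neg)
  have hvle : ∀ s, 0 ≤ s → s ≤ 1 → v s ≤ K * l * (1 - s) := by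
    intro s h0 h1
    have h2 : s ≤ s ^ α := Real.self_le_rpow_of_le_one h0 h1 hα1.le
    have h3 : s ^ α ≤ 1 := Real.rpow_le_one h0 h1 hα.le
    have h4 : 0 ≤ s ^ α := Real.rpow_nonneg h0 _
    have h5 := hlip (-(l * s ^ α)) (-l) (by rw [abs_neg, abs_of_nonneg (by positivity)]; nlinarith)
      (by rw [abs_neg, abs_of_pos hl])
    rw [hzero, sub_zero, abs_of_nonneg (a := -(l * s ^ α) - -l) (by nlinarith)] at h5
    calc v s ≤ _ := le_abs_self _
      _ ≤ _ := h5
      _ = K * l * (1 - s ^ α) := by ring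
      _ ≤ _ := by gcongr
  have hvpos : ∀ s, 0 ≤ s → s < 1 → 0 ≤ v s := fun s h0 h1 => (hpos s h0 h1).le
  set C := K * l with hC
  have hC0 : 0 ≤ C := by positivity
  set G := Gamma (1 - α) with hGdef
  have hG : 0 < G := Gamma_pos_of_pos (by linarith)
  have main : ∀ h, 0 < h → h < 1 → 1 ≤ G * l * C * h + C * h ^ (1 - α) := by
    intro h h0 h1
    set t := 1 - h with ht
    have ht0 : 0 < t := by linarith
    have ht1 : t < 1 := by linarith
    have hI : ∀ a T, IntervalIntegrable (fun s => (T - s) ^ (1 - α - 1) * v s) volume a T :=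
      fun a T => ml_int a (1 - α) T (by linarith) v hvc
    have hI1 := hI 0 1
    have hIa : IntervalIntegrable (fun s => (1 - s) ^ (1 - α - 1) * v s) volume 0 t :=
      hI1.mono_set (by rw [uIcc_of_le ht0.le, uIcc_of_le zero_le_one]; exact Icc_subset_Icc_right ht1.le)
    have e1 := ml_caputo α l 1 hα hα1 hl one_pos
    have et := ml_caputo α l t hα hα1 hl ht0
    change ∫ s in 0..1, (1 - s) ^ (1 - α - 1) * v s = 1 ^ (1 - α) / (1 - α) - G * l * ∫ s in 0..1, v s at e1
    change ∫ s in 0..t, (t - s) ^ (1 - α - 1) * v s = t ^ (1 - α) / (1 - α) - G * l * ∫ s in 0..t, v s at et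
    rw [← intervalIntegral.integral_add_adjacent_intervals hIa (hI t 1),
      ← intervalIntegral.integral_add_adjacent_intervals (hvc.intervalIntegrable 0 t)
        (hvc.intervalIntegrable t 1), Real.one_rpow] at e1
    have b1 : ∫ s in 0..t, (1 - s) ^ (1 - α - 1) * v s ≤ ∫ s in 0..t, (t - s) ^ (1 - α - 1) * v s := by
      refine intervalIntegral.integral_mono_on_of_le_Ioo ht0.le hIa (hI 0 t) fun s hs => ?_
      refine mul_le_mul_of_nonneg_right ?_ (hvpos s hs.1.le (hs.2.trans ht1))
      exact Real.rpow_le_rpow_of_nonpos (by linarith [hs.2]) (by linarith) (by linarith)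
    have b2 : ∫ s in t..1, (1 - s) ^ (1 - α - 1) * v s ≤ ∫ s in t..1, C * h ^ (1 - α) := by
      refine intervalIntegral.integral_mono_on_of_le_Ioo ht1.le (hI t 1) (by simp) fun s hs => ?_
      have hs0 : 0 < 1 - s := by linarith [hs.2]
      calc (1 - s) ^ (1 - α - 1) * v s ≤ (1 - s) ^ (1 - α - 1) * (C * (1 - s)) := by
            gcongr
            exact hvle s (by linarith [hs.1]) (by linarith)
        _ = C * (1 - s) ^ (1 - α) := by
            have : (1 - s) ^ (1 - α) = (1 - s) ^ (1 - α - 1) * (1 - s) := by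
              rw [← Real.rpow_add_one hs0.ne']; ring_nf
            rw [this]; ring
        _ ≤ _ := by
            gcongr
            linarith [hs.1]
    have b3 : ∫ s in t..1, v s ≤ ∫ s in t..1, C * h := by
      refine intervalIntegral.integral_mono_on_of_le_Ioo ht1.le (hvc.intervalIntegrable t 1) (by simp) fun s hs => ?_
      refine (hvle s (by linarith [hs.1]) hs.2.le).trans ?_
      gcongr
      linarith [hs.1]
    rw [intervalIntegral.integral_const, smul_eq_mul, show 1 - t = h by linarith] at b2 b3
    have b4 : t ^ (1 - α) ≤ 1 - (1 - α) * h := by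
      have := rpow_one_add_le_one_add_mul_self (s := -h) (by linarith) (p := 1 - α) (by linarith) (by linarith)
      rw [← sub_eq_add_neg] at this
      linarith
    have b5 : h ≤ 1 / (1 - α) - t ^ (1 - α) / (1 - α) := by
      rw [← sub_div, le_div_iff₀ (by linarith)]; linarith
    have b6 := mul_le_mul_of_nonneg_left b3 (show 0 ≤ G * l by positivity)
    have b7 : h * 1 ≤ h * (G * l * C * h + C * h ^ (1 - α)) := by
      nlinarith
    exact le_of_mul_le_mul_left b7 h0
  have hlim : Tendsto (fun h : ℝ => G * l * C * h + C * h ^ (1 - α)) (𝓝[>] 0) (𝓝 0) := by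
    have hc : Continuous (fun h : ℝ => G * l * C * h + C * h ^ (1 - α)) :=
      (continuous_const.mul continuous_id).add
        (continuous_const.mul (Real.continuous_rpow_const (by linarith)))
    have := hc.tendsto 0
    rw [Real.zero_rpow (by linarith)] at this
    simp only [mul_zero, add_zero] at this
    exact this.mono_left nhdsWithin_le_nhds
  have : (1:ℝ) ≤ 0 := by
    refine ge_of_tendsto hlim ?_
    filter_upwards [Ioo_mem_nhdsGT (zero_lt_one (α := ℝ))] with h hh
    exact main h hh.1 hh.2
  linarith

theorem ml_zero (α : ℝ) : mittagLeffler α 1 0 = 1 := by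
  rw [mittagLeffler, tsum_eq_single 0]
  · simp
  · intro m hm; simp [hm]

theorem ml_pos (α : ℝ) (hα : 0 < α) (hα1 : α < 1) (z : ℝ) (hz : 0 ≤ z) :
    0 < mittagLeffler α 1 (-z) := by
  by_contra hcon
  push Not at hcon
  have hc : Continuous (fun x => mittagLeffler α 1 (-x)) := (ml_cont α 1 hα le_rfl).comp continuous_neg
  set S := {x : ℝ | 0 ≤ x ∧ mittagLeffler α 1 (-x) ≤ 0} with hS
  have hSc : IsClosed S := (isClosed_le continuous_const continuous_id).inter (isClosed_le hc continuous_const)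
  have hSb : BddBelow S := ⟨0, fun x hx => hx.1⟩
  have hmem := hSc.csInf_mem ⟨z, hz, hcon⟩ hSb
  set l := sInf S with hl
  have hbelow : ∀ x, 0 ≤ x → x < l → 0 < mittagLeffler α 1 (-x) := by
    intro x h0 h1
    by_contra h2
    exact absurd (csInf_le hSb (show x ∈ S from ⟨h0, not_lt.1 h2⟩)) (not_le.2 h1)
  have hl0 : 0 < l := by
    refine lt_of_le_of_ne hmem.1 fun h => ?_
    have := hmem.2
    rw [← h, neg_zero, ml_zero] at this
    linarith
  have hzero : mittagLeffler α 1 (-l) = 0 := by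
    refine le_antisymm hmem.2 ?_
    have ht : Tendsto (fun x => mittagLeffler α 1 (-x)) (𝓝[<] l) (𝓝 (mittagLeffler α 1 (-l))) :=
      (hc.tendsto l).mono_left nhdsWithin_le_nhds
    refine ge_of_tendsto ht ?_
    filter_upwards [Ioo_mem_nhdsLT hl0] with x hx
    exact (hbelow x hx.1.le hx.2).le
  refine ml_no_zero α l hα hα1 hl0 (fun s h0 h1 => ?_) hzero
  have h3 : s ^ α < 1 := Real.rpow_lt_one h0 h1 hα
  have h4 : 0 ≤ s ^ α := Real.rpow_nonneg h0 _
  exact hbelow _ (by positivity) (by nlinarith)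

/-- For `0 < α < 1` and every `z > 0`, `0 < E_{α,1}(−z) < 1`. -/
theorem mittagLeffler_pos_lt_one (α : ℝ) (hα : 0 < α) (hα1 : α < 1)
    (z : ℝ) (hz : 0 < z) :
    0 < mittagLeffler α 1 (-z) ∧ mittagLeffler α 1 (-z) < 1 := by
  refine ⟨ml_pos α hα hα1 z hz.le, ?_⟩
  have h := ml_frac α α z 1 hα hα hz one_pos
  rw [Real.one_rpow, mul_one, mul_one] at h
  have hvc : Continuous (fun s : ℝ => mittagLeffler α 1 (-(z * s ^ α))) :=
    (ml_cont α 1 hα le_rfl).comp (((Real.continuous_rpow_const hα.le).const_mul z).neg)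
  have hp : 0 < ∫ s in (0:ℝ)..1, (1 - s) ^ (α - 1) * mittagLeffler α 1 (-(z * s ^ α)) := by
    refine intervalIntegral.intervalIntegral_pos_of_pos_on (ml_int 0 α 1 hα _ hvc) (fun s hs => ?_) one_pos
    refine mul_pos (Real.rpow_pos_of_pos (by linarith [hs.2]) _) (ml_pos α hα hα1 _ ?_)
    have := Real.rpow_nonneg hs.1.le α
    positivity
  rw [h] at hp
  have hE : 0 < mittagLeffler α (1 + α) (-z) := pos_of_mul_pos_right hp (Gamma_pos_of_pos hα).le
  rw [ml_rec α 1 _ hα le_rfl, Real.Gamma_one]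
  nlinarith [mul_pos hz hE]
end

section
/- Let 0 < α < 1. Then there exists a constant C > 0 (depending only on α) such that for every real z ≥ 0 one has E_{α,α}(−z) ≤ C / (1 + z). -/
open PowerSeries Filter Topology Finset

/-- Coefficients of `(1-X)^(-s)`. -/
noncomputable def mlR (s : ℝ) (n : ℕ) : ℝ := ∏ j ∈ Finset.range n, (s + j) / (j + 1)

noncomputable def mlU (s : ℝ) : PowerSeries ℝ := PowerSeries.mk (mlR s)

lemma mlR_zero (s : ℝ) : mlR s 0 = 1 := by simp [mlR]

lemma mlR_succ (s : ℝ) (n : ℕ) : mlR s (n+1) * (n+1) = (s + n) * mlR s n := by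
  have : (n:ℝ) + 1 ≠ 0 := by positivity
  rw [mlR, Finset.prod_range_succ, mlR]; field_simp

lemma mlR_nonneg {s : ℝ} (hs : 0 ≤ s) (n : ℕ) : 0 ≤ mlR s n :=
  Finset.prod_nonneg fun j _ => by positivity

lemma mlR_at_one (n : ℕ) : mlR 1 n = 1 := by
  refine Finset.prod_eq_one fun j _ => ?_
  have : (j:ℝ) + 1 ≠ 0 := by positivity
  rw [add_comm, div_self this]

lemma mlR_at_zero (n : ℕ) : mlR 0 n = if n = 0 then 1 else 0 := by
  cases n with
  | zero => simp [mlR]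
  | succ k => simp [mlR, Finset.prod_range_succ']

lemma mlR_neg {a : ℝ} (ha : 0 < a) (ha1 : a < 1) (n : ℕ) : mlR (-a) (n+1) ≤ 0 := by
  rw [mlR, Finset.prod_range_succ']
  refine mul_nonpos_of_nonneg_of_nonpos (Finset.prod_nonneg fun j _ => ?_) ?_
  · have : (0:ℝ) ≤ j := j.cast_nonneg
    apply div_nonneg <;> push_cast <;> linarith
  · simp; exact ha.le

lemma ml_coeff_ode (F : PowerSeries ℝ) (n : ℕ) :
    coeff n ((1 - X) * d⁄dX ℝ F) = coeff (n+1) F * (n+1) - n * coeff n F := by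
  rw [sub_mul, one_mul, map_sub, coeff_derivative]
  cases n with
  | zero => simp
  | succ k => rw [coeff_succ_X_mul, coeff_derivative]; push_cast; ring

lemma mlU_ode (s : ℝ) : (1 - X) * d⁄dX ℝ (mlU s) = C s * mlU s := by
  ext n
  rw [ml_coeff_ode, coeff_C_mul, mlU, coeff_mk, coeff_mk, mlR_succ]; ring

lemma mlU_mul (s t : ℝ) : mlU s * mlU t = mlU (s + t) := by
  have h : (1 - X) * d⁄dX ℝ (mlU s * mlU t) = C (s + t) * (mlU s * mlU t) := by
    rw [Derivation.leibniz, smul_eq_mul, smul_eq_mul, map_add]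
    linear_combination mlU s * mlU_ode t + mlU t * mlU_ode s
  ext n
  induction n with
  | zero => simp [mlU, mlR_zero, PowerSeries.coeff_mul]
  | succ k ih =>
    have h1 := congrArg (coeff k) h
    have h3 : ∀ j, coeff j (mlU (s + t)) = mlR (s + t) j := fun j => by rw [mlU, coeff_mk]
    rw [ml_coeff_ode, coeff_C_mul, ih, h3] at h1
    have h2 := mlR_succ (s+t) k
    rw [h3]
    have : (k:ℝ) + 1 ≠ 0 := by positivity
    apply mul_right_cancel₀ this
    linarith

lemma ml_summable_s8 (k : ℕ) {r : ℝ} (h0 : 0 ≤ r) (h1 : r < 1) :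
    Summable fun m : ℕ => ((m:ℝ) + 2) ^ k * r ^ m := by
  have h : Summable fun m : ℕ => ((m:ℝ)) ^ k * r ^ m :=
    summable_pow_mul_geometric_of_norm_lt_one k (by rwa [Real.norm_of_nonneg h0])
  have h3 : Summable fun m : ℕ => 2^k * (((m:ℝ)) ^ k * r ^ m) + 2^k * 2^k * r^m :=
    (h.mul_left _).add ((summable_geometric_of_lt_one h0 h1).mul_left _)
  refine Summable.of_nonneg_of_le (fun m => by positivity) (fun m => ?_) h3
  have hm : (0:ℝ) ≤ m := m.cast_nonneg
  have : ((m:ℝ)+2)^k ≤ 2^k * (m:ℝ)^k + 2^k*2^k := by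
    rcases le_total (m:ℝ) 2 with h | h
    · calc ((m:ℝ)+2)^k ≤ (2*2)^k := by gcongr; linarith
        _ = 2^k*2^k := by rw [mul_pow]
        _ ≤ _ := by have : 0 ≤ 2^k * (m:ℝ)^k := by positivity
                    linarith
    · calc ((m:ℝ)+2)^k ≤ (2*m)^k := by gcongr; linarith
        _ = 2^k*m^k := by rw [mul_pow]
        _ ≤ _ := by have : (0:ℝ) ≤ 2^k * 2^k := by positivity
                    linarith
  nlinarith [pow_nonneg h0 m]

lemma mlR_le {s : ℝ} (hs : 0 ≤ s) (n : ℕ) : mlR s n ≤ (1 + s)^n := by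
  rw [← Finset.card_range n, ← Finset.prod_const, Finset.card_range]
  refine Finset.prod_le_prod (fun j _ => by positivity) fun j _ => ?_
  rw [div_le_iff₀ (by positivity)]
  have : (0:ℝ) ≤ j := j.cast_nonneg
  nlinarith

/-- Coefficients of `1/((1-X)^a + l)`. -/
noncomputable def mlG (a l : ℝ) : PowerSeries ℝ :=
  PowerSeries.mk fun n => ∑' m : ℕ, (-l)^m * mlR (a * m + a) n

lemma mlG_summable {a l : ℝ} (ha : 0 < a) (ha1 : a < 1) (hl : 0 ≤ l) (hl1 : l < 1)
    (n : ℕ) : Summable fun m : ℕ => (-l)^m * mlR (a * m + a) n := by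
  refine Summable.of_norm_bounded (ml_summable_s8 n hl hl1) fun m => ?_
  have h0 : 0 ≤ a * m + a := by positivity
  have hm : (0:ℝ) ≤ m := m.cast_nonneg
  rw [norm_mul, norm_pow, norm_neg, Real.norm_of_nonneg hl, Real.norm_of_nonneg (mlR_nonneg h0 n),
    mul_comm]
  gcongr
  refine (mlR_le h0 n).trans ?_
  have : 1 + (a * m + a) ≤ m + 2 := by nlinarith
  gcongr

lemma mlG_eq {a l : ℝ} (ha : 0 < a) (ha1 : a < 1) (hl : 0 ≤ l) (hl1 : l < 1) : (mlU (-a) + C l) * mlG a l = 1 := by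
  have hs := fun n => mlG_summable ha ha1 hl hl1 n
  ext n
  rw [add_mul, map_add, coeff_C_mul, PowerSeries.coeff_mul]
  have e1 : ∑ p ∈ antidiagonal n, coeff p.1 (mlU (-a)) * coeff p.2 (mlG a l)
      = ∑' m : ℕ, (-l)^m * mlR (a * m) n := by
    have e0 : ∀ p : ℕ × ℕ, coeff p.1 (mlU (-a)) * coeff p.2 (mlG a l)
        = ∑' m : ℕ, mlR (-a) p.1 * ((-l)^m * mlR (a * m + a) p.2) := fun p => by
      rw [mlG, mlU, coeff_mk, coeff_mk, tsum_mul_left]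
    rw [Finset.sum_congr rfl fun p _ => e0 p]
    have hsm : ∀ p ∈ antidiagonal n,
        Summable fun m : ℕ => mlR (-a) p.1 * ((-l)^m * mlR (a * m + a) p.2) := by
      intro p _
      exact Summable.mul_left (mlR (-a) p.1) (hs p.2)
    rw [← Summable.tsum_finsetSum hsm]
    refine tsum_congr fun m => ?_
    have := congrArg (coeff n) (mlU_mul (-a) (a * m + a))
    rw [PowerSeries.coeff_mul, show -a + (a * m + a) = a * m by ring] at this
    simp only [mlU, coeff_mk] at this ⊢
    rw [← this, Finset.mul_sum]
    exact Finset.sum_congr rfl fun p _ => by ring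
  have h2 : Summable fun m : ℕ => (-l)^m * mlR (a * m) n := by
    rw [← summable_nat_add_iff 1]
    refine ((hs n).mul_left (-l)).congr fun m => ?_
    push_cast; rw [mul_add, mul_one]; ring
  rw [e1, h2.tsum_eq_zero_add, mlG, coeff_mk, ← tsum_mul_left]
  have e2 : ∑' m : ℕ, (-l)^(m+1) * mlR (a * ((m+1 : ℕ):ℝ)) n
      = - ∑' m : ℕ, l * ((-l)^m * mlR (a * m + a) n) := by
    rw [← tsum_neg]
    refine tsum_congr fun m => ?_
    push_cast; rw [mul_add, mul_one]; ring
  rw [e2]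
  simp [mlR_at_zero, PowerSeries.coeff_one]

lemma mlG_nonneg {a l : ℝ} (ha : 0 < a) (ha1 : a < 1) (hl : 0 ≤ l) (hl1 : l < 1)
    (n : ℕ) : 0 ≤ coeff n (mlG a l) := by
  induction n using Nat.strong_induction_on with
  | _ n ih =>
    have h := congrArg (coeff n) (mlG_eq ha ha1 hl hl1)
    rw [add_mul, map_add, coeff_C_mul, PowerSeries.coeff_mul,
      Finset.Nat.sum_antidiagonal_eq_sum_range_succ_mk, Finset.sum_range_succ'] at h
    have h3 : ∑ k ∈ range n, coeff (k+1) (mlU (-a)) * coeff (n - (k+1)) (mlG a l) ≤ 0 := by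
      refine Finset.sum_nonpos fun k hk => ?_
      rw [mlU, coeff_mk]
      have := Finset.mem_range.1 hk
      exact mul_nonpos_of_nonpos_of_nonneg (mlR_neg ha ha1 k) (ih _ (by omega))
    have h4 : (0:ℝ) ≤ coeff n (1 : PowerSeries ℝ) := by
      rw [PowerSeries.coeff_one]; split_ifs <;> norm_num
    have h5 : coeff 0 (mlU (-a)) = 1 := by rw [mlU, coeff_mk, mlR_zero]
    simp only [h5, Nat.sub_zero, one_mul] at h
    by_contra hc
    push Not at hc
    nlinarith

lemma mlG_le {a l : ℝ} (ha : 0 < a) (ha1 : a < 1) (hl : 0 ≤ l) (hl1 : l < 1)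
    (n : ℕ) : coeff n (mlG a l) ≤ mlR a n := by
  have h : mlG a l = mlU a - C l * (mlU a * mlG a l) := by
    have h1 := mlU_mul a (-a)
    have h0 : mlU (a + -a) = 1 := by
      ext n; rw [add_neg_cancel, mlU, coeff_mk, mlR_at_zero, PowerSeries.coeff_one]
    rw [h0] at h1
    linear_combination (-mlG a l) * h1 + mlU a * mlG_eq ha ha1 hl hl1
  have h2 := congrArg (coeff n) h
  rw [map_sub, coeff_C_mul, PowerSeries.coeff_mul] at h2
  have : 0 ≤ ∑ p ∈ antidiagonal n, coeff p.1 (mlU a) * coeff p.2 (mlG a l) :=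
    Finset.sum_nonneg fun p _ => mul_nonneg (by rw [mlU, coeff_mk]; exact mlR_nonneg ha.le _)
      (mlG_nonneg ha ha1 hl hl1 _)
  have h3 : coeff n (mlU a) = mlR a n := by rw [mlU, coeff_mk]
  rw [h3] at h2
  nlinarith

lemma mlG_sum_le {a l : ℝ} (ha : 0 < a) (ha1 : a < 1) (hl : 0 ≤ l) (hl1 : l < 1)
    (n : ℕ) : l * ∑ j ∈ range (n+1), coeff j (mlG a l) ≤ 1 := by
  have h : mlU 1 - C l * (mlU 1 * mlG a l) = mlU (1 + -a) * mlG a l := by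
    rw [← mlU_mul]
    linear_combination (- mlU 1) * mlG_eq ha ha1 hl hl1
  have h2 := congrArg (coeff n) h
  rw [map_sub, coeff_C_mul, PowerSeries.coeff_mul, PowerSeries.coeff_mul] at h2
  have h3 : 0 ≤ ∑ p ∈ antidiagonal n, coeff p.1 (mlU (1 + -a)) * coeff p.2 (mlG a l) :=
    Finset.sum_nonneg fun p _ => mul_nonneg
      (by rw [mlU, coeff_mk]; exact mlR_nonneg (by linarith) _)
      (mlG_nonneg ha ha1 hl hl1 _)
  have h4 : ∀ k, coeff k (mlU 1) = 1 := fun k => by rw [mlU, coeff_mk, mlR_at_one]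
  simp only [h4, one_mul] at h2
  rw [Finset.Nat.sum_antidiagonal_eq_sum_range_succ_mk] at h2
  simp only at h2
  have h5 := Finset.sum_range_reflect (fun j => coeff j (mlG a l)) (n+1)
  simp only [Nat.add_sub_cancel] at h5
  rw [h5] at h2
  linarith

lemma mlG_step {a l : ℝ} (ha : 0 < a) (ha1 : a < 1) (hl : 0 ≤ l) (hl1 : l < 1)
    (n : ℕ) : coeff (n+1) (mlG a l) * (n+1) - n * coeff n (mlG a l)
    ≤ a * coeff n (mlG a l) := by
  have h := mlG_eq ha ha1 hl hl1
  have hd := congrArg (d⁄dX ℝ) h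
  have h1 : d⁄dX ℝ (1 : PowerSeries ℝ) = 0 := Derivation.map_one_eq_zero _
  have hC : d⁄dX ℝ (C l : PowerSeries ℝ) = 0 := derivative_C
  rw [Derivation.leibniz, h1, map_add, hC, smul_eq_mul, smul_eq_mul, add_zero] at hd
  have ho := mlU_ode (-a)
  have hn : (C (-a) : PowerSeries ℝ) = - C a := map_neg _ _
  rw [hn] at ho
  have key : (1 - X) * d⁄dX ℝ (mlG a l) = C a * (mlG a l - C l * (mlG a l * mlG a l)) := by
    generalize mlG a l = G at *
    generalize d⁄dX ℝ G = G' at *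
    generalize mlU (-a) = U at *
    generalize d⁄dX ℝ U = U' at *
    linear_combination (-(1-X) * G' + C a * G) * h + (1 - X) * G * hd - G * G * ho
  have h2 := congrArg (coeff n) key
  rw [ml_coeff_ode, coeff_C_mul, map_sub, coeff_C_mul, PowerSeries.coeff_mul] at h2
  have h3 : 0 ≤ ∑ p ∈ antidiagonal n, coeff p.1 (mlG a l) * coeff p.2 (mlG a l) :=
    Finset.sum_nonneg fun p _ => mul_nonneg (mlG_nonneg ha ha1 hl hl1 _)
      (mlG_nonneg ha ha1 hl hl1 _)
  have := mul_nonneg ha.le (mul_nonneg hl h3)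
  nlinarith

lemma mlG_bound {a l : ℝ} (ha : 0 < a) (ha1 : a < 1) (hl : 0 ≤ l) (hl1 : l < 1)
    (n : ℕ) : l * (n * coeff n (mlG a l)) ≤ a := by
  have h : ∀ n : ℕ, n * coeff n (mlG a l) ≤ a * ∑ j ∈ range n, coeff j (mlG a l) := by
    intro n
    induction n with
    | zero => simp
    | succ k ih =>
      have := mlG_step ha ha1 hl hl1 k
      rw [Finset.sum_range_succ]; push_cast
      linarith
  have h1 := mlG_sum_le ha ha1 hl hl1 n
  rw [Finset.sum_range_succ] at h1
  have h2 := mul_nonneg hl (mlG_nonneg ha ha1 hl hl1 n)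
  have h3 := mul_le_mul_of_nonneg_left (h n) hl
  nlinarith

lemma mlR_gammaSeq {s : ℝ} (hs : 0 < s) {n : ℕ} (hn : 0 < n) :
    (n:ℝ)^(1-s) * mlR s n = n / (s + n) * (Real.GammaSeq s n)⁻¹ := by
  have hn' : (0:ℝ) < n := by exact_mod_cast hn
  have hp : ∏ j ∈ range n, (s + (j:ℝ)) ≠ 0 := Finset.prod_ne_zero_iff.2 fun j _ => by positivity
  have hf : ∏ j ∈ range n, ((j:ℝ) + 1) = n.factorial := by
    rw [← Finset.prod_range_add_one_eq_factorial]; push_cast; rfl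
  have hf0 : (n.factorial : ℝ) ≠ 0 := by positivity
  have hr : (n:ℝ)^s ≠ 0 := by positivity
  have hsn : s + n ≠ 0 := by positivity
  rw [mlR, Finset.prod_div_distrib, hf, Real.GammaSeq, Finset.prod_range_succ,
    Real.rpow_sub hn', Real.rpow_one]
  field_simp

lemma mlR_tendsto {s : ℝ} (hs : 0 < s) :
    Tendsto (fun n : ℕ => (n:ℝ)^(1-s) * mlR s n) atTop (𝓝 (Real.Gamma s)⁻¹) := by
  have h1 : Tendsto (fun n : ℕ => (n:ℝ) / (s + n)) atTop (𝓝 1) := by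
    have := tendsto_natCast_div_add_atTop (𝕜 := ℝ) s
    simpa [add_comm] using this
  have h2 := (Real.GammaSeq_tendsto_Gamma s).inv₀ (Real.Gamma_pos_of_pos hs).ne'
  have h3 := h1.mul h2
  rw [one_mul] at h3
  refine h3.congr' ?_
  filter_upwards [eventually_gt_atTop 0] with n hn
  rw [mlR_gammaSeq hs hn]

lemma ml_prod_le {s : ℝ} (hs : 0 < s) {A : ℕ} (hA : 0 < A) {n : ℕ} (hn : A ≤ n) :
    ∏ j ∈ range n, (1 + s / ((j:ℝ)+1)) ≤ (1+s)^A * ((n:ℝ)/A)^s := by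
  have hA' : (0:ℝ) < A := by exact_mod_cast hA
  induction n, hn using Nat.le_induction with
  | base =>
    rw [div_self hA'.ne', Real.one_rpow, mul_one]
    refine (Finset.prod_le_prod (g := fun _ => 1 + s) (fun j _ => by positivity) fun j _ => ?_).trans ?_
    · gcongr
      apply div_le_self hs.le
      have : (0:ℝ) ≤ j := j.cast_nonneg
      linarith
    · simp
  | succ n hn ih =>
    have hn' : (0:ℝ) < n := by exact_mod_cast (lt_of_lt_of_le hA hn)
    rw [Finset.prod_range_succ]
    have key : 1 + s / ((n:ℝ)+1) ≤ (((n:ℝ)+1)/n)^s := by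
      have h1 : 1 / ((n:ℝ)+1) ≤ Real.log (((n:ℝ)+1)/n) := by
        have := Real.one_sub_inv_le_log_of_pos (x := ((n:ℝ)+1)/n) (by positivity)
        refine le_trans (le_of_eq ?_) this
        field_simp; ring
      rw [Real.rpow_def_of_pos (by positivity)]
      refine le_trans ?_ (Real.add_one_le_exp _)
      have := mul_le_mul_of_nonneg_right h1 hs.le
      rw [one_div_mul_eq_div] at this
      linarith
    calc _ ≤ ((1+s)^A * ((n:ℝ)/A)^s) * (((n:ℝ)+1)/n)^s := by gcongr
      _ = _ := by
        rw [mul_assoc, ← Real.mul_rpow (by positivity) (by positivity)]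
        congr 2; push_cast; field_simp

lemma mlR_dom {s : ℝ} (hs : 0 < s) {A : ℕ} (hA : 0 < A) {n : ℕ} (hn : A ≤ n) :
    (n:ℝ)^(1-s) * mlR s n ≤ (1+s)^(A+1) * (A:ℝ)^(-s) := by
  have hA' : (0:ℝ) < A := by exact_mod_cast hA
  have hn' : (0:ℝ) < n := by exact_mod_cast (lt_of_lt_of_le hA hn)
  have h1 : mlR s n * (s + n) = s * ∏ j ∈ range n, (1 + s / ((j:ℝ)+1)) := by
    clear hn hn'
    induction n with
    | zero => simp [mlR]
    | succ k ih =>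
      have hk : (k:ℝ) + 1 ≠ 0 := by positivity
      rw [Finset.prod_range_succ, ← mul_assoc, ← ih]
      have := mlR_succ s k
      push_cast
      field_simp
      linear_combination (s + (k+1)) * this
  have h2 := ml_prod_le hs hA hn
  have h3 : mlR s n * n ≤ s * ((1+s)^A * ((n:ℝ)/A)^s) := by
    have := mul_le_mul_of_nonneg_left h2 hs.le
    have := mul_nonneg (mlR_nonneg hs.le n) hs.le
    linarith
  calc (n:ℝ)^(1-s) * mlR s n = (n:ℝ)^(-s) * (mlR s n * n) := by
        rw [sub_eq_neg_add, Real.rpow_add_one hn'.ne']; ring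
    _ ≤ (n:ℝ)^(-s) * (s * ((1+s)^A * ((n:ℝ)/A)^s)) := by gcongr
    _ = s * (1+s)^A * (A:ℝ)^(-s) := by
        rw [Real.div_rpow hn'.le hA'.le, Real.rpow_neg hn'.le, Real.rpow_neg hA'.le]
        field_simp
    _ ≤ _ := by
        rw [pow_succ, mul_comm s]
        gcongr
        linarith

lemma mlG_tendsto {a z : ℝ} (ha : 0 < a) (ha1 : a < 1) (hz : 0 ≤ z) :
    Tendsto (fun n : ℕ => (n:ℝ)^(1-a) * coeff n (mlG a (z * (n:ℝ)^(-a)))) atTop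
      (𝓝 (mittagLeffler a a (-z))) := by
  obtain ⟨A, hA0, hAz⟩ : ∃ A : ℕ, 0 < A ∧ z < (A:ℝ)^a := by
    have := ((tendsto_rpow_atTop ha).comp tendsto_natCast_atTop_atTop).eventually_gt_atTop z
    obtain ⟨A, h1, h2⟩ := (this.and (eventually_gt_atTop 0)).exists
    exact ⟨A, h2, h1⟩
  have hA' : (0:ℝ) < A := by exact_mod_cast hA0
  have hr0 : 0 ≤ z * (A:ℝ)^(-a) := by positivity
  have hr1 : z * (A:ℝ)^(-a) < 1 := by
    rw [Real.rpow_neg hA'.le, ← div_eq_mul_inv, div_lt_one (by positivity)]; exact hAz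
  have hsum := (ml_summable_s8 (A+1) hr0 hr1).mul_left ((A:ℝ)^(-a))
  have := tendsto_tsum_of_dominated_convergence (𝓕 := atTop)
    (f := fun (n : ℕ) (m : ℕ) => (-z)^m * ((n:ℝ)^(1-(a*m+a)) * mlR (a*m+a) n))
    (g := fun m : ℕ => (-z)^m / Real.Gamma (a * m + a)) hsum ?_ ?_
  · refine this.congr' ?_
    filter_upwards [eventually_gt_atTop 0] with n hn
    have hn' : (0:ℝ) < n := by exact_mod_cast hn
    rw [mlG, coeff_mk, ← tsum_mul_left]
    refine tsum_congr fun m => ?_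
    have e : (n:ℝ)^(1-(a*m+a)) = (n:ℝ)^(1-a) * ((n:ℝ)^(-a))^m := by
      rw [← Real.rpow_mul_natCast hn'.le, ← Real.rpow_add hn']; congr 1; ring
    rw [e, ← neg_mul, mul_pow]; ring
  · intro m
    rw [div_eq_mul_inv]
    exact (mlR_tendsto (by positivity)).const_mul _
  · filter_upwards [eventually_ge_atTop A] with n hn m
    have hm : (0:ℝ) ≤ m := m.cast_nonneg
    have hs : 0 < a * m + a := by positivity
    have h0 : 0 ≤ (n:ℝ)^(1-(a*m+a)) * mlR (a*m+a) n :=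
      mul_nonneg (by positivity) (mlR_nonneg hs.le n)
    rw [norm_mul, norm_pow, norm_neg, Real.norm_of_nonneg hz, Real.norm_of_nonneg h0]
    have e : (A:ℝ)^(-(a*m+a)) = (A:ℝ)^(-a) * ((A:ℝ)^(-a))^m := by
      rw [← Real.rpow_mul_natCast hA'.le, ← Real.rpow_add hA']; congr 1; ring
    calc _ ≤ z^m * ((1+(a*m+a))^(A+1) * (A:ℝ)^(-(a*m+a))) := by
          exact mul_le_mul_of_nonneg_left (mlR_dom hs hA0 hn) (by positivity)
      _ ≤ z^m * ((m+2)^(A+1) * (A:ℝ)^(-(a*m+a))) := by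
          have : 1 + (a * m + a) ≤ m + 2 := by nlinarith
          gcongr
      _ = _ := by rw [e, mul_pow]; ring

/-- For `0 < α < 1` there exists `C > 0` (depending only on `α`) such that
`E_{α,α}(−z) ≤ C / (1 + z)` for every `z ≥ 0`. -/
theorem mittagLeffler_alpha_alpha_decay (α : ℝ) (hα : 0 < α) (hα1 : α < 1) :
    ∃ C > 0, ∀ z : ℝ, 0 ≤ z → mittagLeffler α α (-z) ≤ C / (1 + z) := by
  have hG := Real.Gamma_pos_of_pos hα
  refine ⟨(Real.Gamma α)⁻¹ + α, by positivity, fun z hz => ?_⟩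
  have ht := mlG_tendsto hα hα1 hz
  have hl : ∀ᶠ n : ℕ in atTop, z * (n:ℝ)^(-α) < 1 := by
    have h := ((tendsto_rpow_neg_atTop hα).comp tendsto_natCast_atTop_atTop).const_mul z
    rw [mul_zero] at h
    exact h.eventually_lt_const one_pos
  have b1 : mittagLeffler α α (-z) ≤ (Real.Gamma α)⁻¹ := by
    refine le_of_tendsto_of_tendsto ht (mlR_tendsto hα) ?_
    filter_upwards [hl] with n hn
    have := mlG_le hα hα1 (by positivity) hn n
    gcongr
  have b2 : z * mittagLeffler α α (-z) ≤ α := by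
    refine le_of_tendsto (ht.const_mul z) ?_
    filter_upwards [hl, eventually_gt_atTop 0] with n hn hn0
    have hn' : (0:ℝ) < n := by exact_mod_cast hn0
    refine le_trans (le_of_eq ?_) (mlG_bound hα hα1 (by positivity) hn n)
    rw [sub_eq_neg_add, Real.rpow_add_one hn'.ne']; ring
  rw [le_div_iff₀ (by positivity)]
  linarith
end
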